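/- arXiv:1708.08418 — 7 statements merged into one kernel-verified Lean document; each statement's English description precedes it below -/
import Mathlib

section
/- Let q ≥ 2 be an integer with 3 ∤ (q+1). Then the number of triples (k,l,m) of integers with 1 ≤ k < l < m ≤ q+1 and k+l+m ≡ 0 (mod q+1) is (q² − q)/6. -/
open Finset

/-- The set of triples `(k,l,m)` of integers with `1 ≤ k < l < m ≤ q+1` and
`k + l + m ≡ 0 (mod q+1)`. -/
def T (q : ℕ) : Finset (ℕ × ℕ × ℕ) :=
  (Finset.Icc 1 (q+1) ×ˢ Finset.Icc 1 (q+1) ×ˢ Finset.Icc 1 (q+1)).filter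
    (fun t => t.1 < t.2.1 ∧ t.2.1 < t.2.2 ∧ (q+1) ∣ (t.1 + t.2.1 + t.2.2))

/-- A positive multiple of `n` that is at most `3 * n` is one of `n`, `2 * n`, `3 * n`. -/
lemma dvd_iff_of_le_three_mul {n s : ℕ} (hs : 0 < s) (hs' : s ≤ 3 * n) :
    n ∣ s ↔ s = n ∨ s = 2 * n ∨ s = 3 * n := by
  constructor
  · rintro ⟨k, rfl⟩
    have hn : 0 < n := Nat.pos_of_mul_pos_right hs
    have hk : k ≤ 3 := by
      rw [mul_comm] at hs'
      exact Nat.le_of_mul_le_mul_right hs' hn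
    interval_cases k <;> omega
  · rintro (h | h | h) <;> simp [h]

/-- The ordered triples of pairwise distinct elements of `{1, …, q+1}` whose sum is divisible
by `q+1`. -/
def distinctTriples (q : ℕ) : Finset (ℕ × ℕ × ℕ) :=
  (Finset.Icc 1 (q+1) ×ˢ Finset.Icc 1 (q+1) ×ˢ Finset.Icc 1 (q+1)).filter
    (fun t => (t.1 ≠ t.2.1 ∧ t.2.1 ≠ t.2.2 ∧ t.1 ≠ t.2.2) ∧ (q+1) ∣ (t.1 + t.2.1 + t.2.2))

lemma mem_T {q a b c : ℕ} : (a, b, c) ∈ T q ↔ 1 ≤ a ∧ a < b ∧ b < c ∧ c ≤ q + 1 ∧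
    (a + b + c = q + 1 ∨ a + b + c = 2 * (q + 1)) := by
  simp only [T, mem_filter, mem_product, mem_Icc]
  constructor
  · rintro ⟨h, h1, h2, h3⟩
    rw [dvd_iff_of_le_three_mul (by omega) (by omega)] at h3
    omega
  · intro h
    rw [dvd_iff_of_le_three_mul (by omega) (by omega)]
    omega

lemma mem_distinctTriples {q a b c : ℕ} : (a, b, c) ∈ distinctTriples q ↔
    (1 ≤ a ∧ a ≤ q + 1) ∧ (1 ≤ b ∧ b ≤ q + 1) ∧ (1 ≤ c ∧ c ≤ q + 1) ∧
    (a ≠ b ∧ b ≠ c ∧ a ≠ c) ∧ (a + b + c = q + 1 ∨ a + b + c = 2 * (q + 1)) := by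
  simp only [distinctTriples, mem_filter, mem_product, mem_Icc]
  constructor
  · rintro ⟨h, h1, h3⟩
    rw [dvd_iff_of_le_three_mul (by omega) (by omega)] at h3
    omega
  · intro h
    rw [dvd_iff_of_le_three_mul (by omega) (by omega)]
    omega

lemma card_distinctTriples_eq_six_mul (q : ℕ) : #(distinctTriples q) = 6 * #(T q) := by
  have h₁ : #{t ∈ distinctTriples q | t.1 < t.2.1 ∧ t.2.1 < t.2.2} = #(T q) := by
    refine card_nbij' (fun t => t) (fun t => t) ?_ ?_ ?_ ?_ <;> rintro ⟨a, b, c⟩ <;>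
      simp [mem_T, mem_distinctTriples] <;> omega
  have h₂ : #{t ∈ distinctTriples q | t.1 < t.2.2 ∧ t.2.2 < t.2.1} = #(T q) := by
    refine card_nbij' (fun t => (t.1, t.2.2, t.2.1)) (fun t => (t.1, t.2.2, t.2.1))
      ?_ ?_ ?_ ?_ <;> rintro ⟨a, b, c⟩ <;> simp [mem_T, mem_distinctTriples] <;> omega
  have h₃ : #{t ∈ distinctTriples q | t.2.1 < t.1 ∧ t.1 < t.2.2} = #(T q) := by
    refine card_nbij' (fun t => (t.2.1, t.1, t.2.2)) (fun t => (t.2.1, t.1, t.2.2))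
      ?_ ?_ ?_ ?_ <;> rintro ⟨a, b, c⟩ <;> simp [mem_T, mem_distinctTriples] <;> omega
  have h₄ : #{t ∈ distinctTriples q | t.2.1 < t.2.2 ∧ t.2.2 < t.1} = #(T q) := by
    refine card_nbij' (fun t => (t.2.1, t.2.2, t.1)) (fun t => (t.2.2, t.1, t.2.1))
      ?_ ?_ ?_ ?_ <;> rintro ⟨a, b, c⟩ <;> simp [mem_T, mem_distinctTriples] <;> omega
  have h₅ : #{t ∈ distinctTriples q | t.2.2 < t.1 ∧ t.1 < t.2.1} = #(T q) := by
    refine card_nbij' (fun t => (t.2.2, t.1, t.2.1)) (fun t => (t.2.1, t.2.2, t.1))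
      ?_ ?_ ?_ ?_ <;> rintro ⟨a, b, c⟩ <;> simp [mem_T, mem_distinctTriples] <;> omega
  have h₆ : #{t ∈ distinctTriples q | t.2.2 < t.2.1 ∧ t.2.1 < t.1} = #(T q) := by
    refine card_nbij' (fun t => (t.2.2, t.2.1, t.1)) (fun t => (t.2.2, t.2.1, t.1))
      ?_ ?_ ?_ ?_ <;> rintro ⟨a, b, c⟩ <;> simp [mem_T, mem_distinctTriples] <;> omega
  have h : #(distinctTriples q) =
      #{t ∈ distinctTriples q | t.1 < t.2.1 ∧ t.2.1 < t.2.2} +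
      #{t ∈ distinctTriples q | t.1 < t.2.2 ∧ t.2.2 < t.2.1} +
      #{t ∈ distinctTriples q | t.2.1 < t.1 ∧ t.1 < t.2.2} +
      #{t ∈ distinctTriples q | t.2.1 < t.2.2 ∧ t.2.2 < t.1} +
      #{t ∈ distinctTriples q | t.2.2 < t.1 ∧ t.1 < t.2.1} +
      #{t ∈ distinctTriples q | t.2.2 < t.2.1 ∧ t.2.1 < t.1} := by
    simp only [card_filter, ← sum_add_distrib]
    rw [card_eq_sum_ones]
    refine sum_congr rfl ?_
    rintro ⟨a, b, c⟩ ht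
    rw [mem_distinctTriples] at ht
    dsimp only
    split_ifs <;> omega
  omega

/-- The representative of `-2 * a` modulo `n` in `{1, …, n}`, for `0 < a < n`. -/
def negTwoMul (n a : ℕ) : ℕ := if 2 * a < n then n - 2 * a else 2 * n - 2 * a

/-- The representative of `-(a + b)` modulo `n` in `{1, …, n}`, for `0 < a + b < 2 * n`. -/
def negAdd (n a b : ℕ) : ℕ := if a + b < n then n - (a + b) else 2 * n - (a + b)

lemma card_distinctTriples {q : ℕ} (h3 : ¬ 3 ∣ q + 1) :
    #(distinctTriples q) + 2 * q = (q + 1) * (q + 1) - (q + 1) := by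
  set A := (Icc 1 q).image fun a => (a, negTwoMul (q + 1) a) with hA
  set B := (Icc 1 q).image fun a => (negTwoMul (q + 1) a, a) with hB
  have memA (a b : ℕ) : (a, b) ∈ A ↔ (1 ≤ a ∧ a ≤ q) ∧ negTwoMul (q + 1) a = b := by
    simp only [hA, mem_image, mem_Icc, Prod.mk.injEq]
    grind
  have memB (a b : ℕ) : (a, b) ∈ B ↔ (1 ≤ b ∧ b ≤ q) ∧ negTwoMul (q + 1) b = a := by
    simp only [hB, mem_image, mem_Icc, Prod.mk.injEq]
    grind
  have cardA : #A = q := by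
    rw [hA, card_image_of_injective _ fun a b h => (Prod.ext_iff.mp h).1, Nat.card_Icc,
      Nat.add_sub_cancel]
  have cardB : #B = q := by
    rw [hB, card_image_of_injective _ fun a b h => (Prod.ext_iff.mp h).2, Nat.card_Icc,
      Nat.add_sub_cancel]
  have hAB : Disjoint A B := by
    rw [disjoint_left]
    rintro ⟨a, b⟩ ha hb
    rw [memA] at ha
    rw [memB] at hb
    unfold negTwoMul at ha hb
    split_ifs at ha hb <;> omega
  have hsub : A ∪ B ⊆ (Icc 1 (q + 1)).offDiag := by
    rintro ⟨a, b⟩ h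
    rw [mem_union, memA, memB] at h
    simp only [mem_offDiag, mem_Icc]
    unfold negTwoMul at h
    split_ifs at h <;> omega
  have hD : #(distinctTriples q) = #((Icc 1 (q + 1)).offDiag \ (A ∪ B)) := by
    refine card_nbij' (fun t => (t.1, t.2.1)) (fun p => (p.1, p.2, negAdd (q + 1) p.1 p.2))
      ?_ ?_ ?_ ?_
    · rintro ⟨a, b, c⟩ h
      rw [mem_coe, mem_distinctTriples] at h
      simp only [mem_coe, mem_sdiff, mem_union, mem_offDiag, mem_Icc, memA, memB]
      unfold negTwoMul
      split_ifs <;> omega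
    · rintro ⟨a, b⟩ h
      simp only [mem_coe, mem_sdiff, mem_union, mem_offDiag, mem_Icc, memA, memB] at h
      rw [mem_coe, mem_distinctTriples]
      unfold negTwoMul at h
      unfold negAdd
      split_ifs at h ⊢ <;> omega
    · rintro ⟨a, b, c⟩ h
      rw [mem_coe, mem_distinctTriples] at h
      simp only [Prod.mk.injEq, true_and]
      unfold negAdd
      split_ifs <;> omega
    · rintro ⟨a, b⟩ _
      rfl
  have hcard := card_sdiff_add_card_eq_card hsub
  rw [card_union_of_disjoint hAB, cardA, cardB, offDiag_card, Nat.card_Icc,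
    Nat.add_sub_cancel] at hcard
  omega

theorem stmt_1 (q : ℕ) (hq : 2 ≤ q) (h3 : ¬ (3 ∣ (q+1))) :
    (T q).card = (q^2 - q) / 6 := by
  have h₁ := card_distinctTriples h3
  have h₂ := card_distinctTriples_eq_six_mul q
  have h₃ : (q + 1) * (q + 1) = q ^ 2 + 2 * q + 1 := by ring
  omega
end

section
/- Let q ≥ 3 be an odd integer with 3 ∤ (q+1), and let x be an odd integer with 1 ≤ x ≤ q. Then x occurs in exactly (q−1)/2 triples of T. -/
open Finset

/-- The number of triples of `T q` in which the integer `x` occurs. -/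
def occ (q x : ℕ) : ℕ :=
  ((T q).filter (fun t => t.1 = x ∨ t.2.1 = x ∨ t.2.2 = x)).card

theorem mem_T_iff (q k l m : ℕ) :
    (k, l, m) ∈ T q ↔ 1 ≤ k ∧ k < l ∧ l < m ∧ m ≤ q + 1 ∧
      (k + l + m = q + 1 ∨ k + l + m = 2 * (q + 1)) := by
  simp only [T, mem_filter, mem_product, mem_Icc]
  constructor
  · rintro ⟨⟨_, _, _⟩, hkl, hlm, c, hc⟩
    have hc3 : c < 3 := by
      by_contra! h
      have := Nat.mul_le_mul_left (q + 1) h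
      omega
    interval_cases c <;> omega
  · rintro ⟨_, _, _, _, h⟩
    refine ⟨by omega, by omega, by omega, ?_⟩
    rcases h with h | h <;> rw [h]
    exact Dvd.intro_left 2 rfl

/-- The smaller elements of the pairs `a < b` in `[1, q+1]` with `q+1 ∣ x + a + b`, `x ∉ {a, b}`,
for odd `q` and `x`. -/
def smallerPartners (q x : ℕ) : Finset ℕ :=
  (Icc 1 ((q - x) / 2) ∪ Icc (q + 1 - x) (q + 1 - x + (x - 1) / 2)).erase
    (min x (if 2 * x < q + 1 then q + 1 - 2 * x else 2 * (q + 1) - 2 * x))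

theorem card_smallerPartners {q x : ℕ} (hodd : Odd q) (hx1 : 1 ≤ x) (hxq : x ≤ q)
    (hxodd : Odd x) : (smallerPartners q x).card = (q - 1) / 2 := by
  obtain ⟨r, rfl⟩ := hodd
  obtain ⟨y, rfl⟩ := hxodd
  rw [smallerPartners, card_erase_of_mem, card_union_of_disjoint, Nat.card_Icc, Nat.card_Icc]
  · omega
  · rw [disjoint_left]
    intro a
    simp only [mem_Icc]
    omega
  · simp only [mem_union, mem_Icc]
    split_ifs <;> omega

theorem stmt_3 (q : ℕ) (hq : 3 ≤ q) (hodd : Odd q) (h3 : ¬ (3 ∣ (q+1)))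
    (x : ℕ) (hx1 : 1 ≤ x) (hxq : x ≤ q) (hxodd : Odd x) :
    occ q x = (q - 1) / 2 := by
  rw [← card_smallerPartners hodd hx1 hxq hxodd, occ]
  obtain ⟨r, rfl⟩ := hodd
  obtain ⟨y, rfl⟩ := hxodd
  refine card_bij (fun t _ => if t.1 = 2 * y + 1 then t.2.1 else t.1) ?_ ?_ ?_
  · rintro ⟨k, l, m⟩ h
    simp only [mem_filter, mem_T_iff] at h
    simp only [smallerPartners, mem_erase, mem_union, mem_Icc]
    split_ifs <;> omega
  · rintro ⟨k, l, m⟩ h ⟨k', l', m'⟩ h' heq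
    simp only [mem_filter, mem_T_iff] at h h'
    simp only [Prod.mk.injEq]
    dsimp only at heq
    split_ifs at heq <;> omega
  · intro a ha
    simp only [smallerPartners, mem_erase, mem_union, mem_Icc] at ha
    obtain ⟨b, hab, hb, hax, hbx, hsum⟩ : ∃ b, a < b ∧ b ≤ 2 * r + 1 + 1 ∧ a ≠ 2 * y + 1 ∧
        b ≠ 2 * y + 1 ∧ (2 * y + 1 + a + b = 2 * r + 1 + 1 ∨
          2 * y + 1 + a + b = 2 * (2 * r + 1 + 1)) := by
      by_cases h : a < 2 * r + 1 - 2 * y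
      · refine ⟨2 * r + 1 - 2 * y - a, ?_⟩
        split_ifs at ha <;> omega
      · refine ⟨2 * (2 * r + 1 + 1) - (2 * y + 1) - a, ?_⟩
        split_ifs at ha <;> omega
    simp only [exists_prop, Prod.exists, mem_filter, mem_T_iff]
    rcases lt_or_gt_of_ne hax with h | h
    · rcases lt_or_gt_of_ne hbx with h' | h'
      · exact ⟨a, b, 2 * y + 1, by omega, if_neg hax⟩
      · exact ⟨a, 2 * y + 1, b, by omega, if_neg hax⟩
    · exact ⟨2 * y + 1, a, b, by omega, if_pos rfl⟩
end

section
/- Let q ≥ 3 be an odd integer with 3 ∤ (q+1), let e ∈ ℂ be a primitive (q+1)-th root of unity, and set u = (q+1)/2. Then Σ_{(k,l,m)∈T} (e^{3uk} + e^{3ul} + e^{3um}) = −(q−1)/2. -/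
open Finset

/-- Each residue class modulo `n` has exactly one representative in `[1, n]`. -/
lemma sum_Icc_ite_dvd_add {M : Type*} [AddCommMonoid M] {n : ℕ} (hn : 0 < n) (s : ℕ) (v : M) :
    ∑ c ∈ Icc 1 n, (if n ∣ s + c then v else 0) = v := by
  have hlt := Nat.mod_lt s hn
  have hdiv := Nat.div_add_mod s n
  have hmem : n ∣ s + (n - s % n) := ⟨s / n + 1, by rw [mul_add]; lia⟩
  rw [Finset.sum_eq_single (n - s % n), if_pos hmem]
  · intro c hc hne
    rw [if_neg]
    intro hdvd
    rw [mem_Icc] at hc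
    have h1 : c ≡ n - s % n [MOD n] := Nat.ModEq.add_left_cancel' s
      ((Nat.modEq_zero_iff_dvd.2 hdvd).trans (Nat.modEq_zero_iff_dvd.2 hmem).symm)
    rcases le_total c (n - s % n) with h | h
    · have := Nat.le_of_dvd (by lia) ((Nat.modEq_iff_dvd' h).1 h1)
      lia
    · have := Nat.le_of_dvd (by lia) ((Nat.modEq_iff_dvd' h).1 h1.symm)
      lia
  · intro h
    exact absurd (mem_Icc.2 ⟨by lia, by lia⟩) h

lemma sum_Icc_neg_one_pow_of_even {R : Type*} [Ring R] {n : ℕ} (hn : Even n) :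
    ∑ a ∈ Icc 1 n, (-1 : R) ^ a = 0 := by
  obtain ⟨u, rfl⟩ := hn
  induction u with
  | zero => simp
  | succ u ih =>
    rw [show u + 1 + (u + 1) = u + u + 1 + 1 by lia, Finset.sum_Icc_succ_top (by lia),
      Finset.sum_Icc_succ_top (by lia), ih]
    simp [pow_succ]

/-- Summing over increasing triples the values of `f` at all three entries is half of the sum of
`f` at the first entry over all triples of distinct entries. -/
lemma two_mul_sum_increasing {R : Type*} [CommRing R] (s : Finset ℕ) (f : ℕ → R)
    (P : ℕ → Prop) [DecidablePred P] :
    2 * ∑ t ∈ (s ×ˢ s ×ˢ s).filter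
        (fun t => t.1 < t.2.1 ∧ t.2.1 < t.2.2 ∧ P (t.1 + t.2.1 + t.2.2)),
        (f t.1 + f t.2.1 + f t.2.2) =
      (∑ a ∈ s, ∑ b ∈ s, ∑ c ∈ s, if P (a + b + c) then f a else 0)
      - (∑ a ∈ s, ∑ b ∈ s, if P (a + a + b) then f a else 0)
      - (∑ a ∈ s, ∑ b ∈ s, if P (a + b + a) then f a else 0)
      - (∑ a ∈ s, ∑ b ∈ s, if P (a + b + b) then f a else 0)
      + 2 * ∑ a ∈ s, if P (a + a + a) then f a else 0 := by
  let G : ℕ → ℕ → ℕ → R := fun a b c => if a < b ∧ b < c ∧ P (a + b + c) then 1 else 0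
  have hT : ∑ t ∈ (s ×ˢ s ×ˢ s).filter
        (fun t => t.1 < t.2.1 ∧ t.2.1 < t.2.2 ∧ P (t.1 + t.2.1 + t.2.2)),
        (f t.1 + f t.2.1 + f t.2.2) =
      ∑ a ∈ s, ∑ b ∈ s, ∑ c ∈ s, (f a * G a b c + f b * G a b c + f c * G a b c) := by
    rw [Finset.sum_filter, Finset.sum_product]
    refine Finset.sum_congr rfl fun a _ => ?_
    rw [Finset.sum_product]
    refine Finset.sum_congr rfl fun b _ => Finset.sum_congr rfl fun c _ => ?_
    simp only [G]
    split_ifs <;> ring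
  have swap12 (F : ℕ → ℕ → ℕ → R) : ∑ a ∈ s, ∑ b ∈ s, ∑ c ∈ s, F a b c =
      ∑ a ∈ s, ∑ b ∈ s, ∑ c ∈ s, F b a c := Finset.sum_comm
  have swap23 (F : ℕ → ℕ → ℕ → R) : ∑ a ∈ s, ∑ b ∈ s, ∑ c ∈ s, F a b c =
      ∑ a ∈ s, ∑ b ∈ s, ∑ c ∈ s, F a c b := Finset.sum_congr rfl fun _ _ => Finset.sum_comm
  have hfirst : ∑ a ∈ s, ∑ b ∈ s, ∑ c ∈ s, (f a * G a b c + f b * G a b c + f c * G a b c) =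
      ∑ a ∈ s, ∑ b ∈ s, ∑ c ∈ s, (f a * G a b c + f a * G b a c + f a * G b c a) := by
    simp only [Finset.sum_add_distrib]
    rw [swap12 (fun a b c => f b * G a b c), swap23 (fun a b c => f c * G a b c),
      swap12 (fun a b c => f b * G a c b)]
  have hdiag : ∀ a ∈ s, ∀ F : ℕ → R, ∑ b ∈ s, (if a = b then F b else 0) = F a := by
    intro a ha F
    rw [Finset.sum_ite_eq, if_pos ha]
  rw [hT, hfirst, two_mul]
  nth_rewrite 2 [swap23]
  have h1 : ∑ a ∈ s, ∑ b ∈ s, (if P (a + a + b) then f a else 0) =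
      ∑ a ∈ s, ∑ b ∈ s, ∑ c ∈ s, if a = b then (if P (a + b + c) then f a else 0) else 0 := by
    rw [swap23]
    refine Finset.sum_congr rfl fun a ha => Finset.sum_congr rfl fun b _ => ?_
    rw [hdiag a ha (fun c => if P (a + c + b) then f a else 0)]
  have h2 : ∑ a ∈ s, ∑ b ∈ s, (if P (a + b + a) then f a else 0) =
      ∑ a ∈ s, ∑ b ∈ s, ∑ c ∈ s, if a = c then (if P (a + b + c) then f a else 0) else 0 := by
    refine Finset.sum_congr rfl fun a ha => Finset.sum_congr rfl fun b _ => ?_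
    rw [hdiag a ha (fun c => if P (a + b + c) then f a else 0)]
  have h3 : ∑ a ∈ s, ∑ b ∈ s, (if P (a + b + b) then f a else 0) =
      ∑ a ∈ s, ∑ b ∈ s, ∑ c ∈ s, if b = c then (if P (a + b + c) then f a else 0) else 0 := by
    refine Finset.sum_congr rfl fun a _ => Finset.sum_congr rfl fun b hb => ?_
    rw [hdiag b hb (fun c => if P (a + b + c) then f a else 0)]
  have h4 : ∑ a ∈ s, (if P (a + a + a) then f a else 0) =
      ∑ a ∈ s, ∑ b ∈ s, ∑ c ∈ s,
        if a = b then (if a = c then (if P (a + b + c) then f a else 0) else 0) else 0 := by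
    refine Finset.sum_congr rfl fun a ha => ?_
    rw [Finset.sum_comm]
    simp only [Finset.sum_ite_eq, if_pos ha]
  rw [h1, h2, h3, h4, Finset.mul_sum]
  simp only [Finset.mul_sum, ← Finset.sum_add_distrib, ← Finset.sum_sub_distrib]
  refine Finset.sum_congr rfl fun a _ => Finset.sum_congr rfl fun b _ =>
    Finset.sum_congr rfl fun c _ => ?_
  have e1 : b + a + c = a + b + c := by ring
  have e2 : b + c + a = a + b + c := by ring
  have e3 : a + c + b = a + b + c := by ring
  have e4 : c + a + b = a + b + c := by ring
  have e5 : c + b + a = a + b + c := by ring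
  simp only [G, e1, e2, e3, e4, e5]
  by_cases hP : P (a + b + c)
  · simp only [hP, and_true, if_true]
    rcases lt_trichotomy a b with h | h | h <;> rcases lt_trichotomy b c with h' | h' | h' <;>
      rcases lt_trichotomy a c with h'' | h'' | h'' <;>
      first
      | (exfalso; lia)
      | (simp [h, h', h'', h.not_gt, h'.not_gt, h''.not_gt, h.ne, h'.ne, h''.ne,
          h.ne', h'.ne', h''.ne'])
      | (subst_vars; simp [*, ne_of_lt, ne_of_gt, not_lt_of_gt] <;> ring)
  · simp [hP]

theorem stmt_7 (q : ℕ) (hq : 3 ≤ q) (hodd : Odd q) (h3 : ¬ (3 ∣ (q+1)))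
    (e : ℂ) (he : IsPrimitiveRoot e (q+1)) :
    ∑ t ∈ T q, (e ^ (3 * ((q+1)/2) * t.1) + e ^ (3 * ((q+1)/2) * t.2.1)
        + e ^ (3 * ((q+1)/2) * t.2.2)) = -((q : ℂ) - 1) / 2 := by
  have hn : Even (q + 1) := hodd.add_one
  have hpos : 0 < q + 1 := q.succ_pos
  have hu : e ^ ((q + 1) / 2) = -1 :=
    (he.pow hpos (Nat.div_mul_cancel hn.two_dvd).symm).eq_neg_one_of_two_right
  have hpow (k : ℕ) : e ^ (3 * ((q + 1) / 2) * k) = (-1) ^ k := by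
    rw [mul_comm 3, mul_assoc, pow_mul, hu, pow_mul]
    norm_num
  simp only [hpow]
  have key := two_mul_sum_increasing (Icc 1 (q + 1)) (fun k => (-1 : ℂ) ^ k) (fun x => q + 1 ∣ x)
  have h1 : ∑ a ∈ Icc 1 (q + 1), ∑ b ∈ Icc 1 (q + 1), ∑ c ∈ Icc 1 (q + 1),
      (if q + 1 ∣ a + b + c then (-1 : ℂ) ^ a else 0) = 0 := by
    simp only [sum_Icc_ite_dvd_add hpos]
    rw [Finset.sum_comm]
    simp only [sum_Icc_neg_one_pow_of_even hn, Finset.sum_const_zero]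
  have h2 : ∑ a ∈ Icc 1 (q + 1), ∑ b ∈ Icc 1 (q + 1),
      (if q + 1 ∣ a + a + b then (-1 : ℂ) ^ a else 0) = 0 := by
    simp only [sum_Icc_ite_dvd_add hpos, sum_Icc_neg_one_pow_of_even hn]
  have h3' : ∑ a ∈ Icc 1 (q + 1), ∑ b ∈ Icc 1 (q + 1),
      (if q + 1 ∣ a + b + a then (-1 : ℂ) ^ a else 0) = 0 := by
    simpa only [add_right_comm] using h2
  have h4 : ∑ a ∈ Icc 1 (q + 1), ∑ b ∈ Icc 1 (q + 1),
      (if q + 1 ∣ a + b + b then (-1 : ℂ) ^ a else 0) = q + 1 := by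
    rw [Finset.sum_comm]
    have (b a : ℕ) : (if q + 1 ∣ a + b + b then (-1 : ℂ) ^ a else 0) =
        if q + 1 ∣ (b + b) + a then 1 else 0 := by
      rw [show a + b + b = b + b + a by ring]
      split_ifs with h
      · have := hn.two_dvd.trans h
        exact Even.neg_one_pow (even_iff_two_dvd.2 (by lia))
      · rfl
    simp only [this, sum_Icc_ite_dvd_add hpos]
    simp
  have h5 : ∑ a ∈ Icc 1 (q + 1), (if q + 1 ∣ a + a + a then (-1 : ℂ) ^ a else 0) = 1 := by
    have hcop : Nat.Coprime (q + 1) 3 :=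
      ((Nat.Prime.coprime_iff_not_dvd Nat.prime_three).2 h3).symm
    have (a : ℕ) : (if q + 1 ∣ a + a + a then (-1 : ℂ) ^ a else 0) =
        if q + 1 ∣ 0 + a then 1 else 0 := by
      simp only [show a + a + a = 3 * a by ring, hcop.dvd_mul_left, zero_add]
      split_ifs with h
      · exact Even.neg_one_pow (even_iff_two_dvd.2 (hn.two_dvd.trans h))
      · rfl
    simp only [this, sum_Icc_ite_dvd_add hpos]
  rw [h1, h2, h3', h4, h5] at key
  have key' : 2 * ∑ t ∈ T q, ((-1 : ℂ) ^ t.1 + (-1) ^ t.2.1 + (-1) ^ t.2.2) =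
    0 - 0 - 0 - (q + 1) + 2 * 1 := key
  linear_combination key' / 2
end

section
/- Let q ≥ 2 be an integer with 3 ∤ (q+1), let e ∈ ℂ be a primitive (q+1)-th root of unity, and let u be an integer with 1 ≤ u ≤ q and 2u ≠ q+1. Then Σ_{(k,l,m)∈T} (e^{3uk} + e^{3ul} + e^{3um}) = 1. -/
open Finset

/-- Inclusion-exclusion for a symmetric function on ordered triples, according to which of the
entries coincide. -/
theorem sum_triples_eq_of_symm {R : Type*} [CommRing R] (S : Finset ℕ) (g : ℕ → ℕ → ℕ → R)
    (h₁ : ∀ a b c, g a b c = g b a c) (h₂ : ∀ a b c, g a b c = g a c b) :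
    ∑ k ∈ S, ∑ l ∈ S, ∑ m ∈ S, g k l m =
      6 * (∑ k ∈ S, ∑ l ∈ S, ∑ m ∈ S, if k < l ∧ l < m then g k l m else 0)
        + 3 * (∑ k ∈ S, ∑ m ∈ S, g k k m) - 2 * ∑ k ∈ S, g k k k := by
  have swap₁ : ∀ G : ℕ → ℕ → ℕ → R, ∑ k ∈ S, ∑ l ∈ S, ∑ m ∈ S, G l k m =
      ∑ k ∈ S, ∑ l ∈ S, ∑ m ∈ S, G k l m := fun G => Finset.sum_comm
  have swap₂ : ∀ G : ℕ → ℕ → ℕ → R, ∑ k ∈ S, ∑ l ∈ S, ∑ m ∈ S, G k m l =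
      ∑ k ∈ S, ∑ l ∈ S, ∑ m ∈ S, G k l m :=
    fun G => Finset.sum_congr rfl fun k _ => Finset.sum_comm
  let A : ℕ → ℕ → ℕ → R := fun k l m => if k < l ∧ l < m then g k l m else 0
  let B : ℕ → ℕ → ℕ → R := fun k l m => if k = l then g k l m else 0
  let C : ℕ → ℕ → ℕ → R := fun k l m => if k = l then if l = m then g k l m else 0 else 0
  have key : ∀ k l m, g k l m = A k l m + A l k m + A k m l + A m k l + A l m k + A m l k
      + (B k l m + B k m l + B l m k) - 2 * C k l m := by
    intro k l m
    have e₁ : g l k m = g k l m := h₁ l k m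
    have e₂ : g k m l = g k l m := h₂ k m l
    have e₃ : g l m k = g k l m := (h₂ l m k).trans e₁
    have e₄ : g m k l = g k l m := (h₁ m k l).trans e₂
    have e₅ : g m l k = g k l m := (h₂ m l k).trans e₄
    simp only [A, B, C, e₁, e₂, e₃, e₄, e₅]
    generalize g k l m = z
    rcases lt_trichotomy k l with h | h | h <;> rcases lt_trichotomy l m with h' | h' | h' <;>
      rcases lt_trichotomy k m with h'' | h'' | h'' <;>
      first
      | (exfalso; omega)
      | (simp (disch := omega) only [if_pos, if_neg]; ring)
  have hA₃ : ∑ k ∈ S, ∑ l ∈ S, ∑ m ∈ S, A m k l = ∑ k ∈ S, ∑ l ∈ S, ∑ m ∈ S, A k l m := by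
    rw [← swap₁ A, ← swap₂ (fun k l m => A l k m)]
  have hA₄ : ∑ k ∈ S, ∑ l ∈ S, ∑ m ∈ S, A l m k = ∑ k ∈ S, ∑ l ∈ S, ∑ m ∈ S, A k l m := by
    rw [← swap₂ A, ← swap₁ (fun k l m => A k m l)]
  have hA₅ : ∑ k ∈ S, ∑ l ∈ S, ∑ m ∈ S, A m l k = ∑ k ∈ S, ∑ l ∈ S, ∑ m ∈ S, A k l m := by
    rw [← hA₃, ← swap₁ (fun k l m => A m k l)]
  have hB₃ : ∑ k ∈ S, ∑ l ∈ S, ∑ m ∈ S, B l m k = ∑ k ∈ S, ∑ l ∈ S, ∑ m ∈ S, B k l m := by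
    rw [← swap₂ B, ← swap₁ (fun k l m => B k m l)]
  have hB : ∑ k ∈ S, ∑ l ∈ S, ∑ m ∈ S, B k l m = ∑ k ∈ S, ∑ m ∈ S, g k k m := by
    rw [← swap₂ B]
    refine Finset.sum_congr rfl fun k hk => Finset.sum_congr rfl fun m _ => ?_
    simp [B, hk]
  have hC : ∑ k ∈ S, ∑ l ∈ S, ∑ m ∈ S, C k l m = ∑ k ∈ S, g k k k := by
    refine Finset.sum_congr rfl fun k hk => ?_
    rw [Finset.sum_eq_single k]
    · simp [C, hk]
    · intro l _ hl
      simp [C, hl.symm]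
    · exact fun h => absurd hk h
  rw [Finset.sum_congr rfl fun k _ => Finset.sum_congr rfl fun l _ =>
    Finset.sum_congr rfl fun m _ => key k l m]
  simp only [Finset.sum_add_distrib, Finset.sum_sub_distrib, ← Finset.mul_sum]
  rw [swap₁ A, swap₂ A, hA₃, hA₄, hA₅, swap₂ B, hB₃, hB, hC]
  ring

theorem sum_Icc_one_pow_eq_zero {R : Type*} [CommRing R] [IsDomain R] {y : R} {n : ℕ}
    (hn : y ^ n = 1) (hy : y ≠ 1) : ∑ k ∈ Finset.Icc 1 n, y ^ k = 0 := by
  have h : ∀ n, (∑ k ∈ Finset.Icc 1 n, y ^ k) * (y - 1) = y ^ (n + 1) - y := by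
    intro n
    induction n with
    | zero => simp
    | succ n ih =>
      rw [Finset.sum_Icc_succ_top (by omega), add_mul, ih]
      ring
  have h' := h n
  rw [pow_succ, hn, one_mul, sub_self] at h'
  exact (mul_eq_zero.mp h').resolve_right (sub_ne_zero.mpr hy)

/-- Every residue class modulo `n` has exactly one representative in `[1, n]`. -/
theorem sum_Icc_one_ite_dvd_add {R : Type*} [AddCommMonoid R] {n : ℕ} (hn : 0 < n) (a : ℕ)
    (f : ℕ → R) :
    ∑ m ∈ Finset.Icc 1 n, (if n ∣ a + m then f m else 0) = f (n - a % n) := by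
  have ha := Nat.mod_lt a hn
  have hd : n ∣ a + (n - a % n) := by
    refine ⟨a / n + 1, ?_⟩
    have := Nat.div_add_mod a n
    rw [mul_add]
    omega
  rw [Finset.sum_eq_single (n - a % n)]
  · rw [if_pos hd]
  · intro m hm hne
    rw [Finset.mem_Icc] at hm
    refine if_neg fun h => hne ?_
    have hmod : m ≡ n - a % n [MOD n] := by
      refine Nat.ModEq.add_left_cancel' a ?_
      exact ((Nat.modEq_zero_iff_dvd).mpr h).trans ((Nat.modEq_zero_iff_dvd).mpr hd).symm
    rcases Nat.lt_or_ge m (n - a % n) with hlt | hge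
    · have := (Nat.modEq_iff_dvd' hlt.le).mp hmod
      exact absurd (Nat.le_of_dvd (by omega) this) (by omega)
    · have := (Nat.modEq_iff_dvd' hge).mp hmod.symm
      by_contra hne'
      exact absurd (Nat.le_of_dvd (by omega) this) (by omega)
  · intro h
    exact absurd (Finset.mem_Icc.mpr ⟨by omega, by omega⟩) h

theorem sum_T_eq {R : Type*} [AddCommMonoid R] (q : ℕ) (F : ℕ → ℕ → ℕ → R) :
    ∑ t ∈ T q, F t.1 t.2.1 t.2.2 =
      ∑ k ∈ Finset.Icc 1 (q + 1), ∑ l ∈ Finset.Icc 1 (q + 1), ∑ m ∈ Finset.Icc 1 (q + 1),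
        if k < l ∧ l < m then (if q + 1 ∣ k + l + m then F k l m else 0) else 0 := by
  simp only [T, Finset.sum_filter, Finset.sum_product, ← ite_and, and_assoc]

/-- The sum of `x ^ k + x ^ l + x ^ m` over `T q`, for `x` a `(q+1)`-th root of unity which is not
a square root of unity. -/
theorem sum_T_pow_eq_one {K : Type*} [Field K] [CharZero K] {q : ℕ} (h3 : ¬ 3 ∣ q + 1) {x : K}
    (hx : x ^ (q + 1) = 1) (hx2 : x ^ 2 ≠ 1) :
    ∑ t ∈ T q, (x ^ t.1 + x ^ t.2.1 + x ^ t.2.2) = 1 := by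
  have hx1 : x ≠ 1 := by
    rintro rfl
    simp at hx2
  have hn : 0 < q + 1 := q.succ_pos
  have hsum := sum_Icc_one_pow_eq_zero hx hx1
  let S := Finset.Icc 1 (q + 1)
  let g : ℕ → ℕ → ℕ → K :=
    fun k l m => if q + 1 ∣ k + l + m then x ^ k + x ^ l + x ^ m else 0
  have hsymm := sum_triples_eq_of_symm S g
    (fun a b c => by simp only [g, add_comm a b, add_comm (x ^ a)])
    (fun a b c => by simp only [g, add_right_comm a b, add_right_comm (x ^ a) (x ^ b)])
  have hk : ∑ k ∈ S, ∑ l ∈ S, ∑ m ∈ S, (if q + 1 ∣ k + l + m then x ^ k else 0) = 0 := by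
    simp only [S, sum_Icc_one_ite_dvd_add hn _ (fun _ => x ^ _), Finset.sum_const,
      ← Finset.smul_sum, hsum, smul_zero]
  have hl : ∑ k ∈ S, ∑ l ∈ S, ∑ m ∈ S, (if q + 1 ∣ k + l + m then x ^ l else 0) = 0 := by
    refine Finset.sum_comm.trans (Eq.trans ?_ hk)
    refine Finset.sum_congr rfl fun k _ => Finset.sum_congr rfl fun l _ => ?_
    simp only [add_comm l k]
  have hm : ∑ k ∈ S, ∑ l ∈ S, ∑ m ∈ S, (if q + 1 ∣ k + l + m then x ^ m else 0) = 0 := by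
    refine Eq.trans (Finset.sum_congr rfl fun k _ => Finset.sum_comm.trans ?_) hl
    refine Finset.sum_congr rfl fun l _ => Finset.sum_congr rfl fun m _ => ?_
    rw [add_right_comm]
  have hall : ∑ k ∈ S, ∑ l ∈ S, ∑ m ∈ S, g k l m = 0 := by
    have : ∀ k l m, g k l m = (if q + 1 ∣ k + l + m then x ^ k else 0) +
        (if q + 1 ∣ k + l + m then x ^ l else 0) +
        (if q + 1 ∣ k + l + m then x ^ m else 0) := by
      intro k l m
      simp only [g]
      split_ifs <;> simp
    simp only [this, Finset.sum_add_distrib, hk, hl, hm, add_zero]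
  have hpair : ∑ k ∈ S, ∑ m ∈ S, g k k m = 0 := by
    have hterm : ∀ k, ∑ m ∈ S, g k k m = x ^ k + x ^ k + ((x ^ 2)⁻¹) ^ k := by
      intro k
      simp only [g, S]
      rw [sum_Icc_one_ite_dvd_add hn (k + k) (fun m => x ^ k + x ^ k + x ^ m)]
      congr 1
      rw [inv_pow]
      refine eq_inv_of_mul_eq_one_left ?_
      rw [← pow_mul, two_mul k |>.symm, ← pow_add]
      have hlt := Nat.mod_lt (2 * k) hn
      have hdiv := Nat.div_add_mod (2 * k) (q + 1)
      rw [show q + 1 - 2 * k % (q + 1) + 2 * k = (q + 1) * (2 * k / (q + 1) + 1) by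
        rw [mul_add]; omega, pow_mul, hx, one_pow]
    have hinv : ∑ k ∈ S, ((x ^ 2)⁻¹) ^ k = 0 :=
      sum_Icc_one_pow_eq_zero (by rw [inv_pow, ← pow_mul, mul_comm, pow_mul, hx]; simp)
        (by simpa using hx2)
    simp only [hterm, Finset.sum_add_distrib, hinv, S, hsum, add_zero]
  have hdiag : ∑ k ∈ S, g k k k = 3 := by
    rw [Finset.sum_eq_single (q + 1)]
    · have : q + 1 ∣ q + 1 + (q + 1) + (q + 1) := ⟨3, by ring⟩
      simp only [g, if_pos this, hx]
      norm_num
    · intro k hk hne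
      refine if_neg fun h => hne ?_
      rw [show k + k + k = 3 * k by ring] at h
      have hdvd := (((Nat.prime_three.coprime_iff_not_dvd).mpr h3).symm).dvd_of_dvd_mul_left h
      have hk' := Finset.mem_Icc.mp hk
      exact le_antisymm hk'.2 (Nat.le_of_dvd hk'.1 hdvd)
    · intro h
      exact absurd (Finset.mem_Icc.mpr ⟨by omega, le_rfl⟩) h
  rw [hall, hpair, hdiag] at hsymm
  rw [sum_T_eq q fun k l m => x ^ k + x ^ l + x ^ m]
  have h6 : (6 : K) ≠ 0 := by norm_num
  refine mul_left_cancel₀ h6 ?_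
  linear_combination -hsymm

theorem stmt_8 (q : ℕ) (hq : 2 ≤ q) (h3 : ¬ (3 ∣ (q+1)))
    (e : ℂ) (he : IsPrimitiveRoot e (q+1))
    (u : ℕ) (hu1 : 1 ≤ u) (huq : u ≤ q) (hu2 : 2 * u ≠ q + 1) :
    ∑ t ∈ T q, (e ^ (3 * u * t.1) + e ^ (3 * u * t.2.1) + e ^ (3 * u * t.2.2))
      = 1 := by
  simp only [pow_mul e (3 * u)]
  refine sum_T_pow_eq_one h3 ?_ fun h => ?_
  · rw [← pow_mul, mul_comm, pow_mul, he.pow_eq_one, one_pow]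
  · rw [← pow_mul, he.pow_eq_one_iff_dvd, mul_assoc] at h
    obtain ⟨c, hc⟩ :=
      (((Nat.prime_three.coprime_iff_not_dvd).mpr h3).symm).dvd_of_dvd_mul_left h
    have hc2 : c < 2 := by
      by_contra! hc2
      nlinarith [Nat.mul_le_mul_left (q + 1) hc2]
    interval_cases c <;> omega
end

section
/- Let q ≥ 2 be an integer with 3 ∤ (q+1), let e ∈ ℂ be a primitive (q+1)-th root of unity, and let (u,v,w) ∈ T be a triple with w = q+1 (that is, the triple contains q+1). Then Σ_{(k,l,m)∈S} e^{uk + vl + wm} = −(q−1), where S is the set of ordered triples obtained by permuting the entries of the triples of T in all 3! ways. -/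
open Finset

/-- The set of ordered triples obtained by permuting the entries of the triples of
`T q` in all `3!` ways: equivalently, the ordered triples of pairwise distinct
integers in `{1, …, q+1}` whose sum is `≡ 0 (mod q+1)`. -/
def S (q : ℕ) : Finset (ℕ × ℕ × ℕ) :=
  (Finset.Icc 1 (q+1) ×ˢ Finset.Icc 1 (q+1) ×ˢ Finset.Icc 1 (q+1)).filter
    (fun t => t.1 ≠ t.2.1 ∧ t.1 ≠ t.2.2 ∧ t.2.1 ≠ t.2.2 ∧ (q+1) ∣ (t.1 + t.2.1 + t.2.2))

/-- Casting to `ZMod n` is injective on the residues `1, …, n`. -/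
lemma cast_zmod_injOn_Icc (n : ℕ) :
    Set.InjOn (fun a : ℕ => (a : ZMod n)) (Finset.Icc 1 n : Finset ℕ) := by
  intro a ha b hb hab
  simp only [Finset.coe_Icc, Set.mem_Icc] at ha hb
  have h := (ZMod.intCast_eq_intCast_iff_dvd_sub (a : ℤ) b n).mp (by exact_mod_cast hab)
  have h0 := Int.eq_zero_of_abs_lt_dvd h (by rw [abs_lt]; constructor <;> omega)
  omega

/-- Every class of `ZMod n` is represented in `1, …, n`. -/
lemma exists_mem_Icc_cast_eq (n : ℕ) [NeZero n] (x : ZMod n) :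
    ∃ a ∈ Finset.Icc 1 n, (a : ZMod n) = x := by
  have hn := NeZero.pos n
  by_cases hx : x = 0
  · exact ⟨n, by simp; omega, by simp [hx]⟩
  · have h0 : x.val ≠ 0 := by simpa using hx
    have := x.val_lt
    exact ⟨x.val, by simp; omega, by simp⟩

/-- A sum over `S q` of a function of the residues of the first two entries, written as a sum over
pairs of residues (the third one being determined). -/
lemma sum_S_eq_sum_zmod (q : ℕ) (f : ZMod (q+1) → ZMod (q+1) → ℂ) :
    ∑ t ∈ S q, f t.1 t.2.1 =
      ∑ k, ∑ l, if k ≠ l ∧ k ≠ -(k+l) ∧ l ≠ -(k+l) then f k l else 0 := by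
  have hinj := cast_zmod_injOn_Icc (q+1)
  have cast_third {a b c : ℕ} (h : (q+1) ∣ a + b + c) :
      (c : ZMod (q+1)) = -((a : ZMod (q+1)) + b) := by
    rw [← ZMod.natCast_eq_zero_iff] at h
    push_cast at h
    linear_combination h
  rw [← Fintype.sum_prod_type'
    (f := fun k l => if k ≠ l ∧ k ≠ -(k+l) ∧ l ≠ -(k+l) then f k l else 0), ← Finset.sum_filter]
  refine Finset.sum_nbij (fun t => ((t.1 : ZMod (q+1)), (t.2.1 : ZMod (q+1)))) ?_ ?_ ?_ ?_
  · rintro ⟨a, b, c⟩ h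
    simp only [S, Finset.mem_filter, Finset.mem_product] at h
    obtain ⟨⟨ha, hb, hc⟩, hab, hac, hbc, hd⟩ := h
    simp only [Finset.mem_filter, Finset.mem_univ, true_and, ← cast_third hd]
    exact ⟨fun h => hab (hinj ha hb h), fun h => hac (hinj ha hc h), fun h => hbc (hinj hb hc h)⟩
  · rintro ⟨a, b, c⟩ h ⟨a', b', c'⟩ h' heq
    simp only [S, Finset.mem_coe, Finset.mem_filter, Finset.mem_product] at h h'
    obtain ⟨⟨ha, hb, hc⟩, -, -, -, hd⟩ := h
    obtain ⟨⟨ha', hb', hc'⟩, -, -, -, hd'⟩ := h'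
    simp only [Prod.mk.injEq] at heq
    have h3 : (c : ZMod (q+1)) = c' := by rw [cast_third hd, cast_third hd', heq.1, heq.2]
    rw [hinj ha ha' heq.1, hinj hb hb' heq.2, hinj hc hc' h3]
  · rintro ⟨k, l⟩ h
    simp only [Finset.coe_filter, Finset.mem_univ, true_and, Set.mem_ofPred_eq] at h
    obtain ⟨a, ha, rfl⟩ := exists_mem_Icc_cast_eq (q+1) k
    obtain ⟨b, hb, rfl⟩ := exists_mem_Icc_cast_eq (q+1) l
    obtain ⟨c, hc, hcv⟩ := exists_mem_Icc_cast_eq (q+1) (-((a : ZMod (q+1)) + b))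
    refine ⟨(a, b, c), ?_, rfl⟩
    rw [← hcv] at h
    simp only [S, Finset.mem_coe, Finset.mem_filter, Finset.mem_product]
    refine ⟨⟨ha, hb, hc⟩, fun h' => h.1 (by rw [h']), fun h' => h.2.1 (by rw [h']),
      fun h' => h.2.2 (by rw [h']), ?_⟩
    rw [← ZMod.natCast_eq_zero_iff]
    push_cast
    rw [hcv]
    ring
  · intro t _
    rfl

/-- Inclusion–exclusion for the condition that `k`, `l`, `-(k+l)` are pairwise distinct, when `3`
is not a zero divisor: any two coincidences force `k = l = 0`. -/
lemma ite_pairwise_ne {R : Type*} [CommRing R] [DecidableEq R]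
    (h3 : ∀ x : R, 3 * x = 0 → x = 0) (k l : R) (z : ℂ) :
    (if k ≠ l ∧ k ≠ -(k+l) ∧ l ≠ -(k+l) then z else 0) =
      z - (if l = k then z else 0) - (if l = -2 * k then z else 0)
        - (if k = -2 * l then z else 0) + 2 * (if k = 0 then if l = 0 then z else 0 else 0) := by
  have e1 : k = -(k+l) ↔ l = -2 * k :=
    ⟨fun h => by linear_combination h, fun h => by linear_combination h⟩
  have e2 : l = -(k+l) ↔ k = -2 * l :=
    ⟨fun h => by linear_combination h, fun h => by linear_combination h⟩
  simp only [ne_eq, e1, e2, eq_comm (a := k) (b := l)]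
  by_cases h0 : k = 0 ∧ l = 0
  · obtain ⟨rfl, rfl⟩ := h0
    simp
    ring
  have key : 3 * k = 0 → 3 * l = 0 → False := fun a b => h0 ⟨h3 k a, h3 l b⟩
  have h12 : l = k → l ≠ -2 * k := fun a b =>
    key (by linear_combination b - a) (by linear_combination b + 2 * a)
  have h13 : l = k → k ≠ -2 * l := fun a b =>
    key (by linear_combination b - 2 * a) (by linear_combination b + a)
  have h23 : l = -2 * k → k ≠ -2 * l := fun a b =>
    key (by linear_combination -b + 2 * a) (by linear_combination 2 * b - a)
  have hz : (if k = 0 then if l = 0 then z else 0 else 0) = 0 := by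
    split_ifs with a b <;> simp_all
  rw [hz]
  by_cases a : l = k
  · rw [if_pos a, if_neg (h12 a), if_neg (h13 a), if_neg fun h => h.1 a]
    ring
  by_cases b : l = -2 * k
  · rw [if_neg a, if_pos b, if_neg (h23 b), if_neg fun h => h.2.1 b]
    ring
  by_cases c : k = -2 * l
  · rw [if_neg a, if_neg b, if_pos c, if_neg fun h => h.2.2 c]
    ring
  · rw [if_neg a, if_neg b, if_neg c, if_pos ⟨a, b, c⟩]
    ring

theorem stmt_9 (q : ℕ) (hq : 2 ≤ q) (h3 : ¬ (3 ∣ (q+1)))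
    (e : ℂ) (he : IsPrimitiveRoot e (q+1))
    (u v w : ℕ) (huvw : (u, v, w) ∈ T q) (hw : w = q + 1) :
    ∑ t ∈ S q, e ^ (u * t.1 + v * t.2.1 + w * t.2.2) = -((q : ℂ) - 1) := by
  subst hw
  simp only [T, Finset.mem_filter, Finset.mem_product, Finset.mem_Icc] at huvw
  obtain ⟨⟨⟨hu1, -⟩, -, -⟩, huv, hvq, hdvd⟩ := huvw
  have hu : (u : ZMod (q+1)) ≠ 0 := by
    rw [Ne, ZMod.natCast_eq_zero_iff]
    exact fun h => absurd (Nat.le_of_dvd hu1 h) (by omega)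
  have hv : (v : ZMod (q+1)) = -u := by
    rw [← ZMod.natCast_eq_zero_iff] at hdvd
    simp only [Nat.cast_add u, Nat.cast_add (u+v), ZMod.natCast_self, add_zero] at hdvd
    linear_combination hdvd
  have hthree (x : ZMod (q+1)) (hx : 3 * x = 0) : x = 0 := by
    have hunit : IsUnit ((3 : ℕ) : ZMod (q+1)) :=
      (ZMod.isUnit_iff_coprime 3 (q+1)).mpr ((Nat.Prime.coprime_iff_not_dvd Nat.prime_three).mpr h3)
    exact hunit.mul_right_eq_zero.mp (by exact_mod_cast hx)
  let ψ := AddChar.zmodChar (q+1) he.pow_eq_one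
  have hψ : ψ.IsPrimitive := AddChar.zmodChar_primitive_of_primitive_root (q+1) he
  have hsum {b : ZMod (q+1)} (hb : b ≠ 0) : ∑ x, ψ (x * b) = 0 := by
    simpa [hb] using AddChar.sum_mulShift b hψ
  have hterm (t : ℕ × ℕ × ℕ) : e ^ (u * t.1 + v * t.2.1 + (q+1) * t.2.2) =
      ψ ((u : ZMod (q+1)) * (t.1 - t.2.1)) := by
    rw [← AddChar.zmodChar_apply' he.pow_eq_one]
    congr 1
    have : ((q : ZMod (q+1)) + 1) = 0 := by exact_mod_cast ZMod.natCast_self (q+1)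
    push_cast
    rw [hv, this]
    ring
  rw [Finset.sum_congr rfl fun t _ => hterm t,
    sum_S_eq_sum_zmod q fun k l => ψ ((u : ZMod (q+1)) * (k - l))]
  simp only [ite_pairwise_ne hthree, Finset.sum_add_distrib, Finset.sum_sub_distrib,
    ← Finset.mul_sum]
  have hall : ∑ k : ZMod (q+1), ∑ l : ZMod (q+1), ψ ((u : ZMod (q+1)) * (k - l)) = 0 := by
    rw [Finset.sum_comm]
    refine Finset.sum_eq_zero fun l _ => ?_
    rw [← hsum hu, ← Equiv.sum_comp (Equiv.subRight l) fun x => ψ (x * (u : ZMod (q+1)))]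
    simp [mul_comm]
  have hdiag : ∑ k : ZMod (q+1), ∑ l : ZMod (q+1),
      (if l = k then ψ ((u : ZMod (q+1)) * (k - l)) else 0) = q + 1 := by
    simp [ZMod.card]
  have hu3 : 3 * (u : ZMod (q+1)) ≠ 0 := fun h => hu (hthree _ h)
  have hsecond : ∑ k : ZMod (q+1), ∑ l : ZMod (q+1),
      (if l = -2 * k then ψ ((u : ZMod (q+1)) * (k - l)) else 0) = 0 := by
    simp only [Finset.sum_ite_eq', Finset.mem_univ, if_true]
    rw [← hsum hu3]
    exact Finset.sum_congr rfl fun k _ => by ring_nf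
  have hfirst : ∑ k : ZMod (q+1), ∑ l : ZMod (q+1),
      (if k = -2 * l then ψ ((u : ZMod (q+1)) * (k - l)) else 0) = 0 := by
    rw [Finset.sum_comm]
    simp only [Finset.sum_ite_eq', Finset.mem_univ, if_true]
    rw [← hsum (neg_ne_zero.mpr hu3)]
    exact Finset.sum_congr rfl fun k _ => by ring_nf
  have hzero : ∑ k : ZMod (q+1), ∑ l : ZMod (q+1),
      (if k = 0 then if l = 0 then ψ ((u : ZMod (q+1)) * (k - l)) else 0 else 0) = 1 := by
    rw [Finset.sum_eq_single 0 (fun k _ hk => by simp [hk]) (by simp)]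
    simp
  rw [hall, hdiag, hsecond, hfirst, hzero]
  ring
end

section
/- Let q ≥ 2 be an integer with 3 ∤ (q+1), let e ∈ ℂ be a primitive (q+1)-th root of unity, and let (u,v,w) ∈ T be a triple with w ≠ q+1 (that is, none of u, v, w equals q+1). Then Σ_{(k,l,m)∈S} e^{uk + vl + wm} = 2, where S is the set of ordered triples obtained by permuting the entries of the triples of T in all 3! ways. -/
open Finset

theorem exists_mem_Icc_natCast_eq (n : ℕ) [NeZero n] (a : ZMod n) :
    ∃ k ∈ Finset.Icc 1 n, (k : ZMod n) = a := by
  have hn : 0 < n := Nat.pos_of_ne_zero (NeZero.ne n)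
  by_cases h : a = 0
  · exact ⟨n, Finset.mem_Icc.2 ⟨hn, le_rfl⟩, by simp [h]⟩
  · refine ⟨a.val, Finset.mem_Icc.2 ⟨?_, (ZMod.val_lt a).le⟩, ZMod.natCast_zmod_val a⟩
    exact Nat.pos_of_ne_zero fun h0 => h ((ZMod.val_eq_zero a).1 h0)

theorem eq_of_mem_Icc_of_natCast_eq {n k l : ℕ} (hk : k ∈ Finset.Icc 1 n)
    (hl : l ∈ Finset.Icc 1 n) (h : (k : ZMod n) = l) : k = l := by
  rw [Finset.mem_Icc] at hk hl
  rcases le_total k l with hkl | hkl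
  · have hd := (Nat.modEq_iff_dvd' hkl).1 ((ZMod.natCast_eq_natCast_iff _ _ _).1 h)
    have := Nat.eq_zero_of_dvd_of_lt hd (by omega)
    omega
  · have hd := (Nat.modEq_iff_dvd' hkl).1 ((ZMod.natCast_eq_natCast_iff _ _ _).1 h.symm)
    have := Nat.eq_zero_of_dvd_of_lt hd (by omega)
    omega

theorem zmodChar_natCast {n : ℕ} [NeZero n] {e : ℂ} (he : e ^ n = 1) (k : ℕ) :
    AddChar.zmodChar n he (k : ZMod n) = e ^ k :=
  AddChar.zmodChar_apply' he k

/-- The sum over `S q` as a sum over pairs of residues `a, b`, the third residue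
being `-(a + b)`. -/
theorem sum_S_eq_sum_zmod_s10 (q : ℕ) {e : ℂ} (he : e ^ (q + 1) = 1) (u v w : ℕ) :
    ∑ t ∈ S q, e ^ (u * t.1 + v * t.2.1 + w * t.2.2) =
      ∑ p : ZMod (q + 1) × ZMod (q + 1) with
          p.1 ≠ p.2 ∧ p.1 ≠ -(p.1 + p.2) ∧ p.2 ≠ -(p.1 + p.2),
        AddChar.zmodChar (q + 1) he (u * p.1 + v * p.2 + w * -(p.1 + p.2)) := by
  have key : ∀ k l m : ℕ, (q + 1) ∣ k + l + m ↔ (m : ZMod (q + 1)) = -(k + l) := by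
    intro k l m
    rw [← ZMod.natCast_eq_zero_iff, eq_neg_iff_add_eq_zero]
    push_cast
    rw [add_comm (m : ZMod (q + 1))]
  refine Finset.sum_bij (fun t _ => ((t.1 : ZMod (q + 1)), (t.2.1 : ZMod (q + 1)))) ?_ ?_ ?_ ?_
  · rintro ⟨k, l, m⟩ ht
    simp only [S, Finset.mem_filter, Finset.mem_product] at ht
    obtain ⟨⟨hk, hl, hm⟩, hkl, hkm, hlm, hd⟩ := ht
    simp only [Finset.mem_filter, Finset.mem_univ, true_and]
    rw [← (key k l m).1 hd]
    exact ⟨fun h => hkl (eq_of_mem_Icc_of_natCast_eq hk hl h),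
      fun h => hkm (eq_of_mem_Icc_of_natCast_eq hk hm h),
      fun h => hlm (eq_of_mem_Icc_of_natCast_eq hl hm h)⟩
  · rintro ⟨k, l, m⟩ ht ⟨k', l', m'⟩ ht' h
    simp only [S, Finset.mem_filter, Finset.mem_product] at ht ht'
    obtain ⟨⟨hk, hl, hm⟩, -, -, -, hd⟩ := ht
    obtain ⟨⟨hk', hl', hm'⟩, -, -, -, hd'⟩ := ht'
    simp only [Prod.mk.injEq] at h
    rw [eq_of_mem_Icc_of_natCast_eq hk hk' h.1, eq_of_mem_Icc_of_natCast_eq hl hl' h.2,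
      eq_of_mem_Icc_of_natCast_eq hm hm' (by rw [(key _ _ _).1 hd, (key _ _ _).1 hd', h.1, h.2])]
  · rintro ⟨a, b⟩ hp
    obtain ⟨k, hk, rfl⟩ := exists_mem_Icc_natCast_eq (q + 1) a
    obtain ⟨l, hl, rfl⟩ := exists_mem_Icc_natCast_eq (q + 1) b
    obtain ⟨m, hm, h⟩ := exists_mem_Icc_natCast_eq (q + 1) (-((k : ZMod (q + 1)) + l))
    simp only [Finset.mem_filter, Finset.mem_univ, true_and, ← h] at hp
    refine ⟨(k, l, m), ?_, rfl⟩
    simp only [S, Finset.mem_filter, Finset.mem_product]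
    exact ⟨⟨hk, hl, hm⟩, fun h => hp.1 (by rw [h]), fun h => hp.2.1 (by rw [h]),
      fun h => hp.2.2 (by rw [h]), (key k l m).2 h⟩
  · rintro ⟨k, l, m⟩ ht
    simp only [S, Finset.mem_filter, Finset.mem_product] at ht
    dsimp only
    rw [← (key k l m).1 ht.2.2.2.2, ← zmodChar_natCast he]
    push_cast
    rfl

/-- Inclusion-exclusion over the coincidences among `a`, `b` and `-(a + b)`. -/
theorem sum_filter_distinct {n : ℕ} [NeZero n] (h3 : IsUnit (3 : ZMod n))
    (g : ZMod n → ZMod n → ℂ) :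
    ∑ p : ZMod n × ZMod n with p.1 ≠ p.2 ∧ p.1 ≠ -(p.1 + p.2) ∧ p.2 ≠ -(p.1 + p.2), g p.1 p.2 =
      ∑ a, ∑ b, g a b - ∑ a, g a a - ∑ a, g a (-2 * a) - ∑ b, g (-2 * b) b + 2 * g 0 0 := by
  have h1 : ∀ a b : ZMod n, a = -(a + b) ↔ b = -2 * a := fun a b =>
    ⟨fun h => by linear_combination h, fun h => by linear_combination h⟩
  have h2 : ∀ a b : ZMod n, b = -(a + b) ↔ a = -2 * b := fun a b =>
    ⟨fun h => by linear_combination h, fun h => by linear_combination h⟩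
  have h0 : ∀ a : ZMod n, a = -2 * a ↔ a = 0 := fun a =>
    ⟨fun h => (h3.mul_right_eq_zero).1 (by linear_combination h), fun h => by simp [h]⟩
  have hpt : ∀ a b : ZMod n,
      (if a ≠ b ∧ a ≠ -(a + b) ∧ b ≠ -(a + b) then g a b else 0) =
        g a b - (if a = b then g a b else 0) - (if b = -2 * a then g a b else 0) -
          (if a = -2 * b then g a b else 0) +
            if a = 0 then if b = 0 then 2 * g a b else 0 else 0 := by
    intro a b
    simp only [ne_eq, h1, h2]
    by_cases hab : a = b
    · subst hab
      simp only [h0]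
      by_cases ha : a = 0 <;> simp [ha]
      ring
    · have hnot : ¬ (b = -2 * a ∧ a = -2 * b) := fun ⟨hb, ha⟩ =>
        hab (sub_eq_zero.1 (by linear_combination hb - ha))
      have hzero : ¬ (a = 0 ∧ b = 0) := fun ⟨ha, hb⟩ => hab (ha.trans hb.symm)
      split_ifs <;> first | ring1 | (exfalso; tauto)
  rw [Finset.sum_filter, Fintype.sum_prod_type]
  simp only [hpt, Finset.sum_add_distrib, Finset.sum_sub_distrib]
  rw [Finset.sum_comm (f := fun a b => if a = -2 * b then g a b else 0)]
  simp

theorem stmt_10 (q : ℕ) (hq : 2 ≤ q) (h3 : ¬ (3 ∣ (q+1)))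
    (e : ℂ) (he : IsPrimitiveRoot e (q+1))
    (u v w : ℕ) (huvw : (u, v, w) ∈ T q) (hw : w ≠ q + 1) :
    ∑ t ∈ S q, e ^ (u * t.1 + v * t.2.1 + w * t.2.2) = 2 := by
  simp only [T, Finset.mem_filter, Finset.mem_product] at huvw
  obtain ⟨⟨hu, hv, hw'⟩, huv, hvw, hd⟩ := huvw
  have hunit : IsUnit (3 : ZMod (q + 1)) := by
    have := (ZMod.isUnit_iff_coprime 3 (q + 1)).2
      ((Nat.Prime.coprime_iff_not_dvd Nat.prime_three).2 h3)
    exact_mod_cast this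
  have hne : ∀ k ∈ Finset.Icc 1 (q + 1), k ≠ q + 1 → 3 * (k : ZMod (q + 1)) ≠ 0 := by
    intro k hk hkq h
    refine hkq (eq_of_mem_Icc_of_natCast_eq hk (Finset.mem_Icc.2 ⟨by omega, le_rfl⟩) ?_)
    rw [hunit.mul_right_eq_zero.1 h, ZMod.natCast_self]
  have hwq := (Finset.mem_Icc.1 hw').2
  have hsum : (u : ZMod (q + 1)) + v + w = 0 := by
    exact_mod_cast (ZMod.natCast_eq_zero_iff _ _).2 hd
  have hψ := AddChar.zmodChar_primitive_of_primitive_root (q + 1) he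
  have hvan : ∀ c : ZMod (q + 1), c ≠ 0 →
      ∑ a, AddChar.zmodChar (q + 1) he.pow_eq_one (a * c) = 0 := fun c hc => by
    rw [AddChar.sum_mulShift c hψ, if_neg hc, Nat.cast_zero]
  rw [sum_S_eq_sum_zmod_s10 q he.pow_eq_one,
    sum_filter_distinct hunit fun a b =>
      AddChar.zmodChar (q + 1) he.pow_eq_one (u * a + v * b + w * -(a + b))]
  have hall : ∑ a, ∑ b, AddChar.zmodChar (q + 1) he.pow_eq_one
      (u * a + v * b + w * -(a + b)) = 0 := by
    refine Finset.sum_eq_zero fun a _ => ?_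
    have hvw' : (v : ZMod (q + 1)) - w ≠ 0 := fun h =>
      hvw.ne (eq_of_mem_Icc_of_natCast_eq hv hw' (sub_eq_zero.1 h))
    calc _ = ∑ b, AddChar.zmodChar (q + 1) he.pow_eq_one (a * (u - w)) *
          AddChar.zmodChar (q + 1) he.pow_eq_one (b * (v - w)) :=
        Finset.sum_congr rfl fun b _ => by
          rw [← AddChar.map_add_eq_mul]; congr 1; ring
      _ = 0 := by rw [← Finset.mul_sum, hvan _ hvw', mul_zero]
  have hline : ∀ (k : ℕ) (f : ZMod (q + 1) → ZMod (q + 1)), k ∈ Finset.Icc 1 (q + 1) →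
      k ≠ q + 1 → (∀ a, f a = a * -(3 * k)) →
      ∑ a, AddChar.zmodChar (q + 1) he.pow_eq_one (f a) = 0 := fun k f hk hkq hf => by
    simp only [hf]
    exact hvan _ (neg_ne_zero.2 (hne k hk hkq))
  rw [hall, hline w _ hw' hw fun a => by linear_combination a * hsum,
    hline v _ hv (by omega) fun a => by linear_combination a * hsum,
    hline u _ hu (by omega) fun a => by linear_combination a * hsum]
  simp
end

section
/- Let q ≥ 2 be an integer with 3 ∤ (q+1). If q is odd, the number of triples of T that do not contain the element q+1 is (q−1)(q−3)/6; if q is even, the number of triples of T that do not contain the element q+1 is (q² − 4q)/6. -/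
open Finset

/-- The pairs `(k, l)` with `k + 1 < l` and `2 * l < n - (k + 1)`; they encode the triples of
positive integers `k + 1 < l < n - (k + 1) - l` with sum `n`. -/
def distinctPartsPairs (n : ℕ) : Finset (Σ _ : ℕ, ℕ) :=
  (Finset.range n).sigma fun k => Finset.Ioc (k + 1) ((n - (k + 1) - 1) / 2)

theorem card_distinctPartsPairs (n : ℕ) :
    (distinctPartsPairs n).card
      = ∑ k ∈ Finset.range n, ((n - (k + 1) - 1) / 2 - (k + 1)) := by
  simp [distinctPartsPairs]

theorem card_distinctPartsPairs_add_six (n : ℕ) (hn : 1 ≤ n) :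
    (distinctPartsPairs (n + 6)).card = (distinctPartsPairs n).card + n := by
  rw [card_distinctPartsPairs, card_distinctPartsPairs, Finset.sum_range_succ',
    Finset.sum_range_succ']
  have shift : ∀ k, (n + 6 - (k + 1 + 1 + 1) - 1) / 2 - (k + 1 + 1 + 1)
      = (n - (k + 1) - 1) / 2 - (k + 1) := by intro k; omega
  simp only [shift, Finset.sum_range_succ]
  omega

theorem card_distinctPartsPairs_closed_form (r : ℕ) :
    ((distinctPartsPairs (6 * r + 1)).card : ℤ) = r * (3 * r - 2) ∧
    ((distinctPartsPairs (6 * r + 2)).card : ℤ) = r * (3 * r - 1) ∧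
    ((distinctPartsPairs (6 * r + 4)).card : ℤ) = r * (3 * r + 1) ∧
    ((distinctPartsPairs (6 * r + 5)).card : ℤ) = r * (3 * r + 2) := by
  induction r with
  | zero => simp [card_distinctPartsPairs, Finset.sum_range_succ]
  | succ r ih =>
    have step : ∀ s, 1 ≤ s → ((distinctPartsPairs (6 * (r + 1) + s)).card : ℤ)
        = (distinctPartsPairs (6 * r + s)).card + (6 * r + s) := by
      intro s hs
      rw [show 6 * (r + 1) + s = 6 * r + s + 6 by ring,
        card_distinctPartsPairs_add_six _ (by omega)]
      push_cast
      ring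
    obtain ⟨h1, h2, h4, h5⟩ := ih
    refine ⟨?_, ?_, ?_, ?_⟩
    · rw [step 1 (by norm_num), h1]; push_cast; ring
    · rw [step 2 (by norm_num), h2]; push_cast; ring
    · rw [step 4 (by norm_num), h4]; push_cast; ring
    · rw [step 5 (by norm_num), h5]; push_cast; ring

theorem mem_T_filter_avoiding (q : ℕ) (t : ℕ × ℕ × ℕ) :
    t ∈ (T q).filter (fun t => ¬ (t.1 = q+1 ∨ t.2.1 = q+1 ∨ t.2.2 = q+1)) ↔
      1 ≤ t.1 ∧ t.1 < t.2.1 ∧ t.2.1 < t.2.2 ∧ t.2.2 ≤ q ∧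
        (t.1 + t.2.1 + t.2.2 = q + 1 ∨ t.1 + t.2.1 + t.2.2 = 2 * (q + 1)) := by
  obtain ⟨k, l, m⟩ := t
  simp only [T, Finset.mem_filter, Finset.mem_product, Finset.mem_Icc]
  constructor
  · rintro ⟨⟨h, hkl, hlm, c, hc⟩, hne⟩
    have c_pos : 0 < c := by
      rcases Nat.eq_zero_or_pos c with rfl | h0
      · omega
      · exact h0
    have c_lt : c < 3 := by
      by_contra! h
      have := Nat.mul_le_mul_left (q + 1) h
      omega
    interval_cases c <;> omega
  · rintro ⟨h1, h2, h3, h4, h | h⟩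
    · exact ⟨⟨by omega, h2, h3, 1, by omega⟩, by omega⟩
    · exact ⟨⟨by omega, h2, h3, 2, by omega⟩, by omega⟩

theorem card_T_filter_avoiding (q : ℕ) :
    ((T q).filter (fun t => ¬ (t.1 = q+1 ∨ t.2.1 = q+1 ∨ t.2.2 = q+1))).card
      = 2 * (distinctPartsPairs (q + 1)).card := by
  rw [← Finset.card_filter_add_card_filter_not (fun t => t.1 + t.2.1 + t.2.2 = q + 1), two_mul]
  congr 1
  · refine Finset.card_nbij' (fun t => ⟨t.1 - 1, t.2.1⟩)
      (fun p => (p.1 + 1, p.2, q + 1 - (p.1 + 1) - p.2)) ?_ ?_ ?_ ?_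
    · rintro ⟨k, l, m⟩ h
      rw [Finset.mem_coe, Finset.mem_filter, mem_T_filter_avoiding] at h
      simp only [distinctPartsPairs, Finset.mem_coe, Finset.mem_sigma, Finset.mem_range,
        Finset.mem_Ioc] at h ⊢
      omega
    · rintro ⟨k, l⟩ h
      rw [Finset.mem_coe, Finset.mem_filter, mem_T_filter_avoiding]
      simp only [distinctPartsPairs, Finset.mem_coe, Finset.mem_sigma, Finset.mem_range,
        Finset.mem_Ioc] at h ⊢
      omega
    · rintro ⟨k, l, m⟩ h
      rw [Finset.mem_coe, Finset.mem_filter, mem_T_filter_avoiding] at h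
      simp only [Prod.mk.injEq, true_and] at h ⊢
      omega
    · rintro ⟨k, l⟩ _
      simp
  · refine Finset.card_nbij' (fun t => ⟨q + 1 - t.2.2 - 1, q + 1 - t.2.1⟩)
      (fun p => (p.1 + 1 + p.2, q + 1 - p.2, q + 1 - (p.1 + 1))) ?_ ?_ ?_ ?_
    · rintro ⟨k, l, m⟩ h
      rw [Finset.mem_coe, Finset.mem_filter, mem_T_filter_avoiding] at h
      simp only [distinctPartsPairs, Finset.mem_coe, Finset.mem_sigma, Finset.mem_range,
        Finset.mem_Ioc] at h ⊢
      omega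
    · rintro ⟨k, l⟩ h
      rw [Finset.mem_coe, Finset.mem_filter, mem_T_filter_avoiding]
      simp only [distinctPartsPairs, Finset.mem_coe, Finset.mem_sigma, Finset.mem_range,
        Finset.mem_Ioc] at h ⊢
      omega
    · rintro ⟨k, l, m⟩ h
      rw [Finset.mem_coe, Finset.mem_filter, mem_T_filter_avoiding] at h
      simp only [Prod.mk.injEq] at h ⊢
      omega
    · rintro ⟨k, l⟩ h
      simp only [distinctPartsPairs, Finset.mem_coe, Finset.mem_sigma, Finset.mem_range,
        Finset.mem_Ioc, Sigma.mk.injEq, heq_eq_eq] at h ⊢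
      omega

theorem stmt_11 (q : ℕ) (hq : 2 ≤ q) (h3 : ¬ (3 ∣ (q+1))) :
    (Odd q →
      ((T q).filter (fun t => ¬ (t.1 = q+1 ∨ t.2.1 = q+1 ∨ t.2.2 = q+1))).card
        = (q - 1) * (q - 3) / 6) ∧
    (Even q →
      ((T q).filter (fun t => ¬ (t.1 = q+1 ∨ t.2.1 = q+1 ∨ t.2.2 = q+1))).card
        = (q^2 - 4 * q) / 6) := by
  rw [card_T_filter_avoiding]
  obtain ⟨r, hr⟩ : ∃ r, q + 1 = 6 * r + 1 ∨ q + 1 = 6 * r + 2 ∨ q + 1 = 6 * r + 4 ∨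
      q + 1 = 6 * r + 5 := ⟨(q + 1) / 6, by omega⟩
  obtain ⟨h1, h2, h4, h5⟩ := card_distinctPartsPairs_closed_form r
  refine ⟨fun hodd => ?_, fun heven => ?_⟩
  · rw [Nat.odd_iff] at hodd
    have key : (q - 1) * (q - 3) = 6 * (2 * (distinctPartsPairs (q + 1)).card) := by
      have hq3 : 3 ≤ q := by omega
      zify [hq3, show 1 ≤ q by omega]
      rcases hr with hr | hr | hr | hr
      · omega
      · rw [hr, h2, show q = 6 * r + 1 by omega]; push_cast; ring
      · rw [hr, h4, show q = 6 * r + 3 by omega]; push_cast; ring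
      · omega
    rw [key, Nat.mul_div_cancel_left _ (by norm_num)]
  · rw [Nat.even_iff] at heven
    have key : q ^ 2 - 4 * q = 6 * (2 * (distinctPartsPairs (q + 1)).card) := by
      have hq4 : 4 * q ≤ q ^ 2 := by
        have : 4 ≤ q := by omega
        nlinarith
      zify [hq4]
      rcases hr with hr | hr | hr | hr
      · rw [hr, h1, show q = 6 * r by omega]; push_cast; ring
      · omega
      · omega
      · rw [hr, h5, show q = 6 * r + 4 by omega]; push_cast; ring
    rw [key, Nat.mul_div_cancel_left _ (by norm_num)]
end
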